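/- arXiv:2109.09024 — 2 statements merged into one kernel-verified Lean document; each statement's English description precedes it below -/
import Mathlib

section
/- Let α > -1 and β ∈ ℝ, and for d ∈ (-1, 1) set I(d) = ∫_{-1}^{1} (1 - y²)^α (1 + d y)^{-β} dy. Then there exists K = K(α, β) ≥ 1 such that for all d ∈ (-1, 1): (i) if α + 1 - β > 0 then 1/K ≤ I(d) ≤ K; (ii) if α + 1 - β = 0 then 1/K ≤ I(d) / (1 + |log(1 - d²)|) ≤ K; (iii) if α + 1 - β < 0 then 1/K ≤ I(d) · (1 - d²)^{β - α - 1} ≤ K. -/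
open Filter Set
open MeasureTheory intervalIntegral

theorem rpow_le_const_mul_rpow {a b K : ℝ} (p : ℝ) (ha : 0 < a) (hb : 0 < b) (hK : 1 ≤ K)
    (hab : a ≤ K * b) (hba : b ≤ K * a) : b ^ p ≤ K ^ |p| * a ^ p := by
  have hK0 : 0 < K := by linarith
  rcases le_or_gt 0 p with hp | hp
  · rw [abs_of_nonneg hp, ← Real.mul_rpow hK0.le ha.le]
    exact Real.rpow_le_rpow hb.le hba hp
  · have h : a / K ≤ b := by rw [div_le_iff₀ hK0]; linarith
    calc b ^ p ≤ (a / K) ^ p := Real.rpow_le_rpow_of_nonpos (by positivity) h hp.le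
      _ = K ^ |p| * a ^ p := by
        rw [abs_of_neg hp, Real.div_rpow ha.le hK0.le, Real.rpow_neg hK0.le]; ring

/-- The integrand, in terms of the distance `t = 1 - y` to the right endpoint. -/
noncomputable def shiftedIntegrand (α β d t : ℝ) : ℝ :=
  (1 - (1 - t) ^ 2) ^ α * (1 + d * (1 - t)) ^ (-β)

theorem one_add_mul_pos {d x : ℝ} (hd : |d| < 1) (hx : |x| ≤ 1) : 0 < 1 + d * x := by
  have h : |d * x| < 1 := by
    rw [abs_mul]
    nlinarith [abs_nonneg d, abs_nonneg x]
  linarith [(abs_lt.1 h).1]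

theorem intervalIntegrable_shiftedIntegrand {α : ℝ} (β : ℝ) {d : ℝ} (hα : -1 < α)
    (hd : |d| < 1) : IntervalIntegrable (shiftedIntegrand α β d) volume 0 1 := by
  have h : IntervalIntegrable
      (fun t : ℝ => t ^ α * ((2 - t) ^ α * (1 + d * (1 - t)) ^ (-β))) volume 0 1 := by
    refine (intervalIntegrable_rpow' hα).mul_continuousOn ?_
    rw [uIcc_of_le zero_le_one]
    refine ContinuousOn.mul ?_ ?_
    · refine ContinuousOn.rpow_const (by fun_prop) fun t ht => Or.inl ?_
      linarith [ht.2]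
    · refine ContinuousOn.rpow_const (by fun_prop) fun t ht => Or.inl ?_
      exact (one_add_mul_pos hd (abs_le.2 ⟨by linarith [ht.2], by linarith [ht.1]⟩)).ne'
  refine h.congr ?_
  rw [uIoc_of_le zero_le_one]
  intro t ht
  have : 1 - (1 - t) ^ 2 = t * (2 - t) := by ring
  simp only [shiftedIntegrand]
  rw [this, Real.mul_rpow ht.1.le (by linarith [ht.2]), mul_assoc]

theorem setIntegral_eq_integral_shiftedIntegrand_add {α : ℝ} (β : ℝ) {d : ℝ} (hα : -1 < α)
    (hd : |d| < 1) :
    ∫ y in Ioo (-1 : ℝ) 1, (1 - y ^ 2) ^ α * (1 + d * y) ^ (-β) =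
      ∫ t in (0 : ℝ)..1, (shiftedIntegrand α β d t + shiftedIntegrand α β (-d) t) := by
  have hp := intervalIntegrable_shiftedIntegrand β hα hd
  have hm := intervalIntegrable_shiftedIntegrand β hα (d := -d) (by rwa [abs_neg])
  set f : ℝ → ℝ := fun y => (1 - y ^ 2) ^ α * (1 + d * y) ^ (-β) with hf
  have ep : shiftedIntegrand α β d = fun t => f (1 - t) := rfl
  have em : shiftedIntegrand α β (-d) = fun t => f (t - 1) := by
    funext t
    simp only [shiftedIntegrand, hf]
    congr 2 <;> ring
  have ip : IntervalIntegrable f volume 0 1 := by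
    have := hp.comp_sub_left 1
    simp only [ep, sub_sub_cancel, sub_zero, sub_self] at this
    exact this.symm
  have im : IntervalIntegrable f volume (-1) 0 := by
    have := hm.comp_add_right 1
    simpa only [em, add_sub_cancel_right, zero_sub, sub_self] using this
  rw [← integral_Ioc_eq_integral_Ioo, ← integral_of_le (by norm_num),
    ← integral_add_adjacent_intervals im ip, integral_add hp hm, ep, em,
    integral_comp_sub_left, integral_comp_sub_right]
  simp [add_comm]

theorem shiftedIntegrand_add_bounds (α β : ℝ) {d t : ℝ} (hd : |d| < 1) (ht : t ∈ Ioc (0 : ℝ) 1) :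
    shiftedIntegrand α β d t + shiftedIntegrand α β (-d) t ≤
        4 ^ |α| * 4 ^ |β| * (t ^ α * (1 + (1 - d ^ 2 + t) ^ (-β))) ∧
      t ^ α * (1 + (1 - d ^ 2 + t) ^ (-β)) ≤
        4 ^ |α| * 4 ^ |β| * (shiftedIntegrand α β d t + shiftedIntegrand α β (-d) t) := by
  wlog h0 : 0 ≤ d generalizing d
  · have := this (d := -d) (by rwa [abs_neg]) (by linarith)
    simpa only [neg_neg, neg_sq, add_comm] using this
  obtain ⟨ht0, ht1⟩ := ht
  rw [abs_of_nonneg h0] at hd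
  have hs : 0 < 1 - d ^ 2 := by nlinarith
  have a0 : 0 < 1 - (1 - t) ^ 2 := by nlinarith
  have b0 : 1 ≤ 1 + d * (1 - t) := by nlinarith
  have b1 : 1 + d * (1 - t) ≤ 2 := by nlinarith
  have c0 : 0 < 1 + -d * (1 - t) := by nlinarith
  have c1 : 1 + -d * (1 - t) ≤ 4 * (1 - d ^ 2 + t) := by nlinarith
  have c2 : 1 - d ^ 2 + t ≤ 4 * (1 + -d * (1 - t)) := by
    nlinarith [mul_nonneg (sub_nonneg.2 hd.le) (sub_nonneg.2 ht1), mul_nonneg h0 ht0.le]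
  have four : (1 : ℝ) ≤ 4 := by norm_num
  have A1 := rpow_le_const_mul_rpow α ht0 a0 four (by nlinarith) (by nlinarith)
  have A2 := rpow_le_const_mul_rpow α a0 ht0 four (by nlinarith) (by nlinarith)
  have B1 := rpow_le_const_mul_rpow (-β) one_pos (by linarith) four (by linarith)
    (show 1 + d * (1 - t) ≤ 4 * 1 by linarith)
  have B2 := rpow_le_const_mul_rpow (-β) (by linarith) one_pos four
    (show 1 + d * (1 - t) ≤ 4 * 1 by linarith) (by linarith)
  have C1 := rpow_le_const_mul_rpow (-β) (by linarith) c0 four c2 c1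
  have C2 := rpow_le_const_mul_rpow (-β) c0 (by linarith) four c1 c2
  rw [abs_neg, Real.one_rpow] at B1 B2
  rw [abs_neg] at C1 C2
  simp only [shiftedIntegrand]
  rw [← mul_add]
  constructor
  · rw [mul_mul_mul_comm]
    exact mul_le_mul A1 (by linarith) (by positivity) (by positivity)
  · rw [mul_mul_mul_comm]
    exact mul_le_mul A2 (by linarith) (by positivity) (by positivity)

theorem intervalIntegrable_rpow_mul_add_rpow {α : ℝ} (β : ℝ) {s a b : ℝ} (hα : -1 < α)
    (hs : 0 < s) (ha : 0 ≤ a) (hab : a ≤ b) :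
    IntervalIntegrable (fun t : ℝ => t ^ α * (s + t) ^ (-β)) volume a b := by
  refine (intervalIntegrable_rpow' hα).mul_continuousOn ?_
  rw [uIcc_of_le hab]
  refine ContinuousOn.rpow_const (by fun_prop) fun t ht => Or.inl ?_
  linarith [ht.1]

theorem integral_rpow_zero_left {α : ℝ} (hα : -1 < α) (s : ℝ) :
    ∫ t in (0 : ℝ)..s, t ^ α = s ^ (α + 1) / (α + 1) := by
  rw [integral_rpow (Or.inl hα), Real.zero_rpow (by linarith), sub_zero]

theorem integral_rpow_mul_add_rpow_bounds {α : ℝ} (β : ℝ) {s : ℝ} (hα : -1 < α)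
    (hs : s ∈ Ioc (0 : ℝ) 1) :
    (∫ t in (0 : ℝ)..1, t ^ α * (s + t) ^ (-β)) ≤
        2 ^ |β| * (s ^ (α + 1 - β) / (α + 1) + ∫ t in s..1, t ^ (α - β)) ∧
      s ^ (α + 1 - β) / (α + 1) + (∫ t in s..1, t ^ (α - β)) ≤
        2 ^ |β| * ∫ t in (0 : ℝ)..1, t ^ α * (s + t) ^ (-β) := by
  obtain ⟨hs0, hs1⟩ := hs
  have two : (1 : ℝ) ≤ 2 := by norm_num
  have i1 := intervalIntegrable_rpow_mul_add_rpow β hα hs0 le_rfl hs0.le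
  have i2 := intervalIntegrable_rpow_mul_add_rpow β hα hs0 hs0.le hs1
  have j1 : IntervalIntegrable (fun t : ℝ => t ^ α * s ^ (-β)) volume 0 s :=
    (intervalIntegrable_rpow' hα).mul_const _
  have j2 : IntervalIntegrable (fun t : ℝ => t ^ (α - β)) volume s 1 := by
    refine intervalIntegrable_rpow (Or.inr ?_)
    rw [uIcc_of_le hs1]
    exact fun h => hs0.not_ge h.1
  have e1 : s ^ (α + 1 - β) / (α + 1) = ∫ t in (0 : ℝ)..s, t ^ α * s ^ (-β) := by
    rw [intervalIntegral.integral_mul_const, integral_rpow_zero_left hα, sub_eq_add_neg,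
      Real.rpow_add hs0]
    ring
  have b1 : ∀ t ∈ Ioo (0 : ℝ) s, t ^ α * (s + t) ^ (-β) ≤ 2 ^ |β| * (t ^ α * s ^ (-β)) ∧
      t ^ α * s ^ (-β) ≤ 2 ^ |β| * (t ^ α * (s + t) ^ (-β)) := by
    rintro t ⟨h0, h1⟩
    have p := rpow_le_const_mul_rpow (-β) hs0 (add_pos hs0 h0) two (by linarith) (by linarith)
    have q := rpow_le_const_mul_rpow (-β) (add_pos hs0 h0) hs0 two (by linarith) (by linarith)
    rw [abs_neg] at p q
    rw [mul_left_comm, mul_left_comm (2 ^ |β|)]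
    exact ⟨by gcongr, by gcongr⟩
  have b2 : ∀ t ∈ Ioo s (1 : ℝ), t ^ α * (s + t) ^ (-β) ≤ 2 ^ |β| * t ^ (α - β) ∧
      t ^ (α - β) ≤ 2 ^ |β| * (t ^ α * (s + t) ^ (-β)) := by
    rintro t ⟨h0, h1⟩
    have ht : 0 < t := by linarith
    have p := rpow_le_const_mul_rpow (-β) ht (add_pos hs0 ht) two (by linarith) (by linarith)
    have q := rpow_le_const_mul_rpow (-β) (add_pos hs0 ht) ht two (by linarith) (by linarith)
    rw [abs_neg] at p q
    rw [sub_eq_add_neg, Real.rpow_add ht, mul_left_comm, mul_left_comm (2 ^ |β|)]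
    exact ⟨by gcongr, by gcongr⟩
  rw [← integral_add_adjacent_intervals i1 i2, e1, mul_add, mul_add,
    ← intervalIntegral.integral_const_mul, ← intervalIntegral.integral_const_mul,
    ← intervalIntegral.integral_const_mul, ← intervalIntegral.integral_const_mul]
  constructor
  · exact add_le_add
      (integral_mono_on_of_le_Ioo hs0.le i1 (j1.const_mul _) fun t ht => (b1 t ht).1)
      (integral_mono_on_of_le_Ioo hs1 i2 (j2.const_mul _) fun t ht => (b2 t ht).1)
  · exact add_le_add
      (integral_mono_on_of_le_Ioo hs0.le j1 (i1.const_mul _) fun t ht => (b1 t ht).2)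
      (integral_mono_on_of_le_Ioo hs1 j2 (i2.const_mul _) fun t ht => (b2 t ht).2)

theorem exists_integral_bounds {α : ℝ} (β : ℝ) (hα : -1 < α) :
    ∃ M : ℝ, 1 ≤ M ∧ ∀ d : ℝ, |d| < 1 →
      (∫ y in Ioo (-1 : ℝ) 1, (1 - y ^ 2) ^ α * (1 + d * y) ^ (-β)) ≤
          M * (1 / (α + 1) + ((1 - d ^ 2) ^ (α + 1 - β) / (α + 1) +
            ∫ t in (1 - d ^ 2)..1, t ^ (α - β))) ∧
        1 / (α + 1) + ((1 - d ^ 2) ^ (α + 1 - β) / (α + 1) +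
            ∫ t in (1 - d ^ 2)..1, t ^ (α - β)) ≤
          M * ∫ y in Ioo (-1 : ℝ) 1, (1 - y ^ 2) ^ α * (1 + d * y) ^ (-β) := by
  have g4 : (1 : ℝ) ≤ 4 ^ |α| * 4 ^ |β| :=
    one_le_mul_of_one_le_of_one_le (Real.one_le_rpow (by norm_num) (abs_nonneg _))
      (Real.one_le_rpow (by norm_num) (abs_nonneg _))
  have g2 : (1 : ℝ) ≤ 2 ^ |β| := Real.one_le_rpow (by norm_num) (abs_nonneg _)
  refine ⟨2 ^ |β| * (4 ^ |α| * 4 ^ |β|), one_le_mul_of_one_le_of_one_le g2 g4, fun d hd => ?_⟩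
  have hA : 0 < 1 / (α + 1) := one_div_pos.2 (by linarith)
  have hs0 : 0 < 1 - d ^ 2 := sub_pos.2 ((sq_lt_one_iff_abs_lt_one d).2 hd)
  have hs1 : 1 - d ^ 2 ≤ 1 := by linarith [sq_nonneg d]
  obtain ⟨hJ1, hJ2⟩ := integral_rpow_mul_add_rpow_bounds β hα ⟨hs0, hs1⟩
  have iG := (intervalIntegrable_shiftedIntegrand β hα hd).add
    (intervalIntegrable_shiftedIntegrand β hα (d := -d) (by rwa [abs_neg]))
  have iα : IntervalIntegrable (fun t : ℝ => t ^ α) volume 0 1 := intervalIntegrable_rpow' hα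
  have iJ := intervalIntegrable_rpow_mul_add_rpow β hα hs0 le_rfl zero_le_one
  have iH : IntervalIntegrable (fun t : ℝ => t ^ α * (1 + (1 - d ^ 2 + t) ^ (-β))) volume 0 1 := by
    simpa only [mul_add, mul_one] using iα.add iJ
  have eH : ∫ t in (0 : ℝ)..1, t ^ α * (1 + (1 - d ^ 2 + t) ^ (-β)) =
      1 / (α + 1) + ∫ t in (0 : ℝ)..1, t ^ α * (1 - d ^ 2 + t) ^ (-β) := by
    simp only [mul_add, mul_one]
    rw [integral_add iα iJ, integral_rpow_zero_left hα, Real.one_rpow]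
  have u1 := integral_mono_on_of_le_Ioo zero_le_one iG (iH.const_mul (4 ^ |α| * 4 ^ |β|))
    fun t ht => (shiftedIntegrand_add_bounds α β hd (Ioo_subset_Ioc_self ht)).1
  have u2 := integral_mono_on_of_le_Ioo zero_le_one iH (iG.const_mul (4 ^ |α| * 4 ^ |β|))
    fun t ht => (shiftedIntegrand_add_bounds α β hd (Ioo_subset_Ioc_self ht)).2
  rw [intervalIntegral.integral_const_mul, eH] at u1 u2
  rw [setIntegral_eq_integral_shiftedIntegrand_add β hα hd]
  constructor
  · refine u1.trans ?_
    rw [mul_comm (2 ^ |β|), mul_assoc _ (2 ^ |β|), mul_add (2 ^ |β|)]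
    gcongr
    exact le_mul_of_one_le_left hA.le g2
  · rw [mul_assoc]
    refine le_trans ?_ (mul_le_mul_of_nonneg_left u2 (by positivity))
    rw [mul_add]
    exact add_le_add (le_mul_of_one_le_left hA.le g2) hJ2

/-- integral computation table for
`I(d) = ∫_{-1}^{1} (1-y²)^α (1+dy)^{-β} dy`, `α > -1`. -/
theorem stmt_13 (α β : ℝ) (hα : -1 < α) :
    ∃ K : ℝ, 1 ≤ K ∧ ∀ d ∈ Set.Ioo (-1:ℝ) 1,
      (0 < α + 1 - β →
        1 / K ≤ (∫ y in Set.Ioo (-1:ℝ) 1, (1 - y ^ 2) ^ α * (1 + d * y) ^ (-β)) ∧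
        (∫ y in Set.Ioo (-1:ℝ) 1, (1 - y ^ 2) ^ α * (1 + d * y) ^ (-β)) ≤ K) ∧
      (α + 1 - β = 0 →
        1 / K ≤ (∫ y in Set.Ioo (-1:ℝ) 1, (1 - y ^ 2) ^ α * (1 + d * y) ^ (-β)) /
            (1 + |Real.log (1 - d ^ 2)|) ∧
        (∫ y in Set.Ioo (-1:ℝ) 1, (1 - y ^ 2) ^ α * (1 + d * y) ^ (-β)) /
            (1 + |Real.log (1 - d ^ 2)|) ≤ K) ∧
      (α + 1 - β < 0 →
        1 / K ≤ (∫ y in Set.Ioo (-1:ℝ) 1, (1 - y ^ 2) ^ α * (1 + d * y) ^ (-β)) *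
            (1 - d ^ 2) ^ (β - α - 1) ∧
        (∫ y in Set.Ioo (-1:ℝ) 1, (1 - y ^ 2) ^ α * (1 + d * y) ^ (-β)) *
            (1 - d ^ 2) ^ (β - α - 1) ≤ K) := by
  obtain ⟨M, hM, hI⟩ := exists_integral_bounds β hα
  set A := 1 / (α + 1) with hA
  have hα' : 0 < α + 1 := by linarith
  have A0 : 0 < A := one_div_pos.2 hα'
  set g := |1 / (α + 1 - β)| with hg
  have g0 : 0 ≤ g := abs_nonneg _
  set C := 1 + 2 * A + (α + 1) + g with hC
  have C1 : 1 ≤ C := by linarith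
  have CA : 1 ≤ C * A := by
    have : (α + 1) * A = 1 := mul_one_div_cancel hα'.ne'
    nlinarith [mul_nonneg g0 A0.le]
  have M0 : 0 < M := by linarith
  have C0 : 0 < C := by linarith
  -- comparability of the explicit expression with `φ` transfers to the integral
  have key : ∀ {I B φ : ℝ}, 0 < φ → I ≤ M * B → B ≤ M * I → B ≤ C * φ → φ ≤ C * B →
      1 / (M * C) ≤ I / φ ∧ I / φ ≤ M * C := by
    intro I B φ hφ h1 h2 h3 h4
    have h5 : I ≤ M * (C * φ) := h1.trans (by gcongr)
    have h6 : φ ≤ C * (M * I) := h4.trans (by gcongr)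
    constructor
    · rw [div_le_div_iff₀ (by positivity) hφ]; linarith
    · rw [div_le_iff₀ hφ]; linarith
  refine ⟨M * C, one_le_mul_of_one_le_of_one_le hM C1, fun d hd => ?_⟩
  have hd' : |d| < 1 := abs_lt.2 hd
  have hs0 : 0 < 1 - d ^ 2 := sub_pos.2 ((sq_lt_one_iff_abs_lt_one d).2 hd')
  have hs1 : 1 - d ^ 2 ≤ 1 := by linarith [sq_nonneg d]
  obtain ⟨h1, h2⟩ := hI d hd'
  set I := ∫ y in Set.Ioo (-1:ℝ) 1, (1 - y ^ 2) ^ α * (1 + d * y) ^ (-β)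
  set s := 1 - d ^ 2
  have n0 : (0 : ℝ) ∉ uIcc s 1 := by
    rw [uIcc_of_le hs1]
    exact fun h => hs0.not_ge h.1
  have hX0 : 0 < s ^ (α + 1 - β) := Real.rpow_pos_of_pos hs0 _
  have eX : s ^ (α + 1 - β) / (α + 1) = A * s ^ (α + 1 - β) := by rw [hA]; ring
  have eL : α + 1 - β ≠ 0 →
      ∫ t in s..1, t ^ (α - β) = (1 - s ^ (α + 1 - β)) * (1 / (α + 1 - β)) := by
    intro h
    rw [integral_rpow (Or.inr ⟨fun h' => h (by linarith), n0⟩), Real.one_rpow,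
      show α - β + 1 = α + 1 - β by ring]
    ring
  rw [eX] at h1 h2
  refine ⟨fun hpos => ?_, fun hzero => ?_, fun hneg => ?_⟩
  · have hX1 : s ^ (α + 1 - β) ≤ 1 := Real.rpow_le_one hs0.le hs1 hpos.le
    rw [eL hpos.ne'] at h1 h2
    rw [abs_of_nonneg (by positivity)] at hg
    rw [← hg] at h1 h2
    have := key one_pos h1 h2 (by nlinarith) (by
      have : 0 ≤ C * (A * s ^ (α + 1 - β) + (1 - s ^ (α + 1 - β)) * g) :=
        mul_nonneg C0.le (add_nonneg (by positivity) (mul_nonneg (by linarith) g0))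
      linarith)
    simpa only [div_one] using this
  · have hl : ∫ t in s..1, t ^ (α - β) = |Real.log s| := by
      rw [show α - β = -1 by linarith, abs_of_nonpos (Real.log_nonpos hs0.le hs1)]
      simp only [Real.rpow_neg_one]
      rw [integral_inv n0, one_div, Real.log_inv]
    rw [hl, hzero, Real.rpow_zero] at h1 h2
    have l0 := abs_nonneg (Real.log s)
    exact key (by positivity) h1 h2 (by nlinarith) (by nlinarith)
  · have hX1 : 1 ≤ s ^ (α + 1 - β) :=
      Real.one_le_rpow_of_pos_of_le_one_of_nonpos hs0 hs1 hneg.le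
    rw [eL hneg.ne] at h1 h2
    rw [abs_of_nonpos (one_div_nonpos.2 hneg.le)] at hg
    have hg' : 1 / (α + 1 - β) = -g := by linarith
    rw [hg'] at h1 h2
    have := key hX0 h1 h2 (by nlinarith) (by
      have : 0 ≤ C * (A + (s ^ (α + 1 - β) - 1) * g) :=
        mul_nonneg C0.le (add_nonneg A0.le (mul_nonneg (by linarith) g0))
      nlinarith)
    rwa [div_eq_mul_inv I, ← Real.rpow_neg hs0.le,
      show -(α + 1 - β) = β - α - 1 by ring] at this
end

section
/- For every p > 1 there exists C > 0 such that every h ∈ H¹_loc(-1, 1) with ‖h‖_{H₀} < ∞ satisfies the three bounds: ∫_{-1}^{1} h(y)² ρ(y)/(1 - y²) dy ≤ C² ‖h‖_{H₀}²; ( ∫_{-1}^{1} |h(y)|^{p+1} ρ(y) dy )^{2/(p+1)} ≤ C² ‖h‖_{H₀}²; and sup_{|y| < 1} |h(y)| (1 - y²)^{1/(p-1)} ≤ C ‖h‖_{H₀}. -/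
open Filter Set MeasureTheory

/-- The weight `ρ(y) = (1-y²)^{2/(p-1)}`. -/
noncomputable def rho (p y : ℝ) : ℝ := (1 - y ^ 2) ^ (2 / (p - 1))

lemma one_sub_sq_pos_of_mem_Ioo {y : ℝ} (hy : y ∈ Ioo (-1 : ℝ) 1) : 0 < 1 - y ^ 2 := by
  nlinarith [hy.1, hy.2]

lemma rho_pos (p : ℝ) {y : ℝ} (hy : y ∈ Ioo (-1 : ℝ) 1) : 0 < rho p y :=
  Real.rpow_pos_of_pos (one_sub_sq_pos_of_mem_Ioo hy) _

lemma hasDerivAt_sq_mul_rho (p : ℝ) {h : ℝ → ℝ} {d y : ℝ} (hy : y ∈ Ioo (-1 : ℝ) 1)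
    (hd : HasDerivAt h d y) :
    HasDerivAt (fun y => h y ^ 2 * rho p y)
      (2 * h y * d * rho p y - 2 * (2 / (p - 1)) * y * (h y ^ 2 * rho p y / (1 - y ^ 2))) y := by
  have hs := one_sub_sq_pos_of_mem_Ioo hy
  have hr : HasDerivAt (rho p) _ y :=
    (((hasDerivAt_id y).pow 2).const_sub 1).rpow_const (p := 2 / (p - 1)) (Or.inl hs.ne')
  refine ((hd.pow 2).mul hr).congr_deriv ?_
  simp only [Pi.pow_apply, id, Real.rpow_sub_one hs.ne', rho]
  push_cast
  field_simp
  ring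

lemma hardy_pointwise {α h d y r : ℝ} (hα : 0 < α) (hy : y ∈ Ioo (-1 : ℝ) 1) (hr : 0 < r) :
    h ^ 2 * r + y * (2 * h * d * r - 2 * α * y * (h ^ 2 * r / (1 - y ^ 2))) ≤
      (1 + 2 * α + 1 / α) * ((d ^ 2 * (1 - y ^ 2) + h ^ 2) * r)
        - α * (h ^ 2 * r / (1 - y ^ 2)) := by
  have hs := one_sub_sq_pos_of_mem_Ioo hy
  generalize hsd : 1 - y ^ 2 = s at *
  have key : (1 + 2 * α + 1 / α) * ((d ^ 2 * s + h ^ 2) * r) - α * (h ^ 2 * r / s)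
      - (h ^ 2 * r + y * (2 * h * d * r - 2 * α * y * (h ^ 2 * r / s)))
      = r * ((α * h - y * d * s) ^ 2 / (α * s) + d ^ 2 * s * (1 - y ^ 2) / α
        + (1 + 2 * α) * (d ^ 2 * s) + h ^ 2 / α) := by
    have : y ^ 2 = 1 - s := by linarith
    field_simp
    ring_nf
    simp only [this]
    ring
  have : 0 ≤ r * ((α * h - y * d * s) ^ 2 / (α * s) + d ^ 2 * s * (1 - y ^ 2) / α
        + (1 + 2 * α) * (d ^ 2 * s) + h ^ 2 / α) := by
    rw [hsd]; positivity
  linarith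

lemma abs_deriv_pointwise {α h d y r : ℝ} (hα : 0 < α) (hy : y ∈ Ioo (-1 : ℝ) 1) (hr : 0 < r) :
    |2 * h * d * r - 2 * α * y * (h ^ 2 * r / (1 - y ^ 2))| ≤
      (d ^ 2 * (1 - y ^ 2) + h ^ 2) * r + (1 + 2 * α) * (h ^ 2 * r / (1 - y ^ 2)) := by
  have hs := one_sub_sq_pos_of_mem_Ioo hy
  have hq : 0 ≤ h ^ 2 * r / (1 - y ^ 2) := by positivity
  have h1 : |2 * α * y * (h ^ 2 * r / (1 - y ^ 2))| ≤ 2 * α * (h ^ 2 * r / (1 - y ^ 2)) := by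
    rw [abs_mul, abs_mul, abs_of_nonneg hq, abs_of_pos (by positivity : 0 < 2 * α)]
    have : |y| ≤ 1 := abs_le.2 ⟨hy.1.le, hy.2.le⟩
    exact mul_le_mul_of_nonneg_right (mul_le_of_le_one_right (by positivity) this) hq
  have h2 : |2 * h * d * r| ≤ d ^ 2 * (1 - y ^ 2) * r + h ^ 2 * r / (1 - y ^ 2) := by
    generalize 1 - y ^ 2 = s at *
    have e1 : d ^ 2 * s * r + h ^ 2 * r / s - 2 * h * d * r = r * (d * s - h) ^ 2 / s := by
      field_simp; ring
    have e2 : d ^ 2 * s * r + h ^ 2 * r / s + 2 * h * d * r = r * (d * s + h) ^ 2 / s := by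
      field_simp; ring
    have p1 : 0 ≤ r * (d * s - h) ^ 2 / s := by positivity
    have p2 : 0 ≤ r * (d * s + h) ^ 2 / s := by positivity
    exact abs_le.2 ⟨by linarith, by linarith⟩
  have h3 := abs_sub (2 * h * d * r) (2 * α * y * (h ^ 2 * r / (1 - y ^ 2)))
  have h4 : 0 ≤ h ^ 2 * r := by positivity
  linarith

lemma setIntegral_Icc_hardy_le {p : ℝ} (hp : 1 < p) {h h' : ℝ → ℝ}
    (hd : ∀ y ∈ Ioo (-1 : ℝ) 1, HasDerivAt h (h' y) y)
    (hF : IntegrableOn (fun y => ((h' y) ^ 2 * (1 - y ^ 2) + h y ^ 2) * rho p y) (Ioo (-1 : ℝ) 1))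
    {a : ℝ} (ha0 : 0 ≤ a) (ha1 : a < 1) :
    IntegrableOn (fun y => h y ^ 2 * rho p y / (1 - y ^ 2)) (Icc (-a) a) ∧
    2 / (p - 1) * ∫ y in Icc (-a) a, h y ^ 2 * rho p y / (1 - y ^ 2) ≤
      (1 + 2 * (2 / (p - 1)) + 1 / (2 / (p - 1))) *
        ∫ y in Ioo (-1 : ℝ) 1, ((h' y) ^ 2 * (1 - y ^ 2) + h y ^ 2) * rho p y := by
  have hα : 0 < 2 / (p - 1) := div_pos two_pos (by linarith)
  set α := 2 / (p - 1) with hαdef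
  have hsub : Icc (-a) a ⊆ Ioo (-1 : ℝ) 1 := fun y hy => ⟨by linarith [hy.1], by linarith [hy.2]⟩
  have hdv := fun y (hy : y ∈ Ioo (-1 : ℝ) 1) => hasDerivAt_sq_mul_rho p hy (hd y hy)
  have hvc : ContinuousOn (fun y => h y ^ 2 * rho p y) (Icc (-a) a) :=
    fun y hy => (hdv y (hsub hy)).continuousAt.continuousWithinAt
  have hqi : IntegrableOn (fun y => h y ^ 2 * rho p y / (1 - y ^ 2)) (Icc (-a) a) :=
    (hvc.div (by fun_prop)
      fun y hy => (one_sub_sq_pos_of_mem_Ioo (hsub hy)).ne').integrableOn_compact isCompact_Icc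
  refine ⟨hqi, ?_⟩
  have hFi := hF.mono_set hsub
  have ftc := intervalIntegral.sub_le_integral_of_hasDeriv_right_of_le (a := -a) (b := a)
    (g := fun y => y * (h y ^ 2 * rho p y)) (by linarith) (continuousOn_id.mul hvc)
    (fun y hy => ((hasDerivAt_id y).mul
      (hdv y (hsub (Ioo_subset_Icc_self hy)))).hasDerivWithinAt)
    ((hFi.const_mul (1 + 2 * α + 1 / α)).sub (hqi.const_mul α))
    (fun y hy => by
      have hy' := hsub (Ioo_subset_Icc_self hy)
      simpa using hardy_pointwise (h := h y) (d := h' y) hα hy' (rho_pos p hy'))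
  simp only [Pi.sub_apply] at ftc
  rw [intervalIntegral.integral_of_le (by linarith), ← integral_Icc_eq_integral_Ioc,
    integral_sub (hFi.const_mul _) (hqi.const_mul _), integral_const_mul, integral_const_mul] at ftc
  have hb1 : 0 ≤ a * (h a ^ 2 * rho p a) :=
    mul_nonneg ha0 (mul_nonneg (sq_nonneg _) (rho_pos p (hsub ⟨by linarith, le_rfl⟩)).le)
  have hb2 : 0 ≤ a * (h (-a) ^ 2 * rho p (-a)) :=
    mul_nonneg ha0 (mul_nonneg (sq_nonneg _) (rho_pos p (hsub ⟨le_rfl, by linarith⟩)).le)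
  have hmono : ∫ y in Icc (-a) a, ((h' y) ^ 2 * (1 - y ^ 2) + h y ^ 2) * rho p y ≤
      ∫ y in Ioo (-1 : ℝ) 1, ((h' y) ^ 2 * (1 - y ^ 2) + h y ^ 2) * rho p y := by
    refine setIntegral_mono_set hF ?_ hsub.eventuallyLE
    filter_upwards [ae_restrict_mem measurableSet_Ioo] with y hy
    have := one_sub_sq_pos_of_mem_Ioo hy
    have := rho_pos p hy
    simp only [Pi.zero_apply]
    positivity
  have := mul_le_mul_of_nonneg_left hmono (by positivity : 0 ≤ 1 + 2 * α + 1 / α)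
  linarith

lemma integrableOn_hardy_and_integral_le {p : ℝ} (hp : 1 < p) {h h' : ℝ → ℝ}
    (hd : ∀ y ∈ Ioo (-1 : ℝ) 1, HasDerivAt h (h' y) y)
    (hF : IntegrableOn (fun y => ((h' y) ^ 2 * (1 - y ^ 2) + h y ^ 2) * rho p y)
      (Ioo (-1 : ℝ) 1)) :
    IntegrableOn (fun y => h y ^ 2 * rho p y / (1 - y ^ 2)) (Ioo (-1 : ℝ) 1) ∧
    ∫ y in Ioo (-1 : ℝ) 1, h y ^ 2 * rho p y / (1 - y ^ 2) ≤
      (1 + 2 * (2 / (p - 1)) + 1 / (2 / (p - 1))) / (2 / (p - 1)) *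
        ∫ y in Ioo (-1 : ℝ) 1, ((h' y) ^ 2 * (1 - y ^ 2) + h y ^ 2) * rho p y := by
  have hα : 0 < 2 / (p - 1) := div_pos two_pos (by linarith)
  let a : ℕ → ℝ := fun n => 1 - 1 / ((n : ℝ) + 1)
  have ha0 : ∀ n, 0 ≤ a n := fun n => by
    have : 1 / ((n : ℝ) + 1) ≤ 1 := by
      rw [div_le_one (by positivity)]; linarith [(Nat.cast_nonneg n : (0 : ℝ) ≤ n)]
    simp only [a]; linarith
  have ha1 : ∀ n, a n < 1 := fun n => by
    have : 0 < 1 / ((n : ℝ) + 1) := by positivity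
    simp only [a]; linarith
  have hlim : Tendsto a atTop (nhds 1) := by
    simpa [a] using (tendsto_const_nhds (x := (1 : ℝ))).sub
      (tendsto_one_div_add_atTop_nhds_zero_nat (𝕜 := ℝ))
  have hcover : AECover (volume.restrict (Ioo (-1 : ℝ) 1)) atTop (fun n => Icc (-(a n)) (a n)) :=
    aecover_Ioo_of_Icc hlim.neg hlim
  have hsub : ∀ n, Icc (-(a n)) (a n) ⊆ Ioo (-1 : ℝ) 1 :=
    fun n y hy => ⟨by linarith [hy.1, ha1 n], by linarith [hy.2, ha1 n]⟩
  have hrestrict : ∀ n, (volume.restrict (Ioo (-1 : ℝ) 1)).restrict (Icc (-(a n)) (a n)) =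
      volume.restrict (Icc (-(a n)) (a n)) := fun n => by
    rw [Measure.restrict_restrict measurableSet_Icc, inter_eq_left.2 (hsub n)]
  have hbound : ∀ n, ∫ y in Icc (-(a n)) (a n), h y ^ 2 * rho p y / (1 - y ^ 2)
        ∂(volume.restrict (Ioo (-1 : ℝ) 1)) ≤
      (1 + 2 * (2 / (p - 1)) + 1 / (2 / (p - 1))) / (2 / (p - 1)) *
        ∫ y in Ioo (-1 : ℝ) 1, ((h' y) ^ 2 * (1 - y ^ 2) + h y ^ 2) * rho p y := fun n => by
    rw [hrestrict, div_mul_eq_mul_div, le_div_iff₀ hα, mul_comm]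
    exact (setIntegral_Icc_hardy_le hp hd hF (ha0 n) (ha1 n)).2
  have hint : IntegrableOn (fun y => h y ^ 2 * rho p y / (1 - y ^ 2)) (Ioo (-1 : ℝ) 1) := by
    refine hcover.integrable_of_integral_bounded_of_nonneg_ae _ (fun n => ?_) ?_
      (Eventually.of_forall hbound)
    · rw [IntegrableOn, hrestrict]
      exact (setIntegral_Icc_hardy_le hp hd hF (ha0 n) (ha1 n)).1
    · filter_upwards [ae_restrict_mem measurableSet_Ioo] with y hy
      have := one_sub_sq_pos_of_mem_Ioo hy
      have := rho_pos p hy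
      positivity
  refine ⟨hint, le_of_tendsto (hcover.integral_tendsto_of_countably_generated hint)
    (Eventually.of_forall hbound)⟩

lemma sub_le_setIntegral_of_abs_deriv_le {v v' G : ℝ → ℝ} {s : Set ℝ} [s.OrdConnected]
    (hs : MeasurableSet s)
    (hv : ∀ y ∈ s, HasDerivAt v (v' y) y) (hG : IntegrableOn G s) (hle : ∀ y ∈ s, |v' y| ≤ G y)
    {x z : ℝ} (hx : x ∈ s) (hz : z ∈ s) : v x - v z ≤ ∫ y in s, G y := by
  have main : ∀ (w w' : ℝ → ℝ), (∀ y ∈ s, HasDerivAt w (w' y) y) → (∀ y ∈ s, w' y ≤ G y) →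
      ∀ a ∈ s, ∀ b ∈ s, a ≤ b → w b - w a ≤ ∫ y in s, G y := by
    intro w w' hw hwG a ha b hb hab
    have hsub : Icc a b ⊆ s := Set.Icc_subset s ha hb
    refine (intervalIntegral.sub_le_integral_of_hasDeriv_right_of_le hab
      (fun y hy => (hw y (hsub hy)).continuousAt.continuousWithinAt)
      (fun y hy => (hw y (hsub (Ioo_subset_Icc_self hy))).hasDerivWithinAt)
      (hG.mono_set hsub) (fun y hy => hwG y (hsub (Ioo_subset_Icc_self hy)))).trans ?_
    rw [intervalIntegral.integral_of_le hab, ← integral_Icc_eq_integral_Ioc]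
    refine setIntegral_mono_set hG ?_ hsub.eventuallyLE
    filter_upwards [ae_restrict_mem hs] with y hy
    exact (abs_nonneg _).trans (hle y hy)
  rcases le_total z x with hzx | hxz
  · exact main v v' hv (fun y hy => (le_abs_self _).trans (hle y hy)) z hz x hx hzx
  · have := main (fun y => -v y) (fun y => -v' y) (fun y hy => (hv y hy).neg)
      (fun y hy => (neg_le_abs _).trans (hle y hy)) x hx z hz hxz
    linarith

lemma sq_mul_rho_le {p : ℝ} (hp : 1 < p) {h h' : ℝ → ℝ}
    (hd : ∀ y ∈ Ioo (-1 : ℝ) 1, HasDerivAt h (h' y) y)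
    (hF : IntegrableOn (fun y => ((h' y) ^ 2 * (1 - y ^ 2) + h y ^ 2) * rho p y) (Ioo (-1 : ℝ) 1))
    {x : ℝ} (hx : x ∈ Ioo (-1 : ℝ) 1) :
    h x ^ 2 * rho p x ≤
      2 * (∫ y in Ioo (-1 : ℝ) 1, ((h' y) ^ 2 * (1 - y ^ 2) + h y ^ 2) * rho p y) +
      (1 + 2 * (2 / (p - 1))) * ∫ y in Ioo (-1 : ℝ) 1, h y ^ 2 * rho p y / (1 - y ^ 2) := by
  have hα : 0 < 2 / (p - 1) := div_pos two_pos (by linarith)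
  have hq := (integrableOn_hardy_and_integral_le hp hd hF).1
  have hosc := fun z (hz : z ∈ Ioo (-1 : ℝ) 1) => sub_le_setIntegral_of_abs_deriv_le
    measurableSet_Ioo (fun y hy => hasDerivAt_sq_mul_rho p hy (hd y hy))
    (hF.add (hq.const_mul (1 + 2 * (2 / (p - 1)))))
    (fun y hy => abs_deriv_pointwise hα hy (rho_pos p hy)) hx hz
  simp only [Pi.add_apply] at hosc
  rw [integral_add hF (hq.const_mul _), integral_const_mul] at hosc
  set N := ∫ y in Ioo (-1 : ℝ) 1, ((h' y) ^ 2 * (1 - y ^ 2) + h y ^ 2) * rho p y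
  set Q := ∫ y in Ioo (-1 : ℝ) 1, h y ^ 2 * rho p y / (1 - y ^ 2)
  have hN : 0 ≤ N := setIntegral_nonneg measurableSet_Ioo fun y hy => by
    have := one_sub_sq_pos_of_mem_Ioo hy
    have := rho_pos p hy
    positivity
  have hmono : ∫ _ in Ioo (-1 : ℝ) 1, (h x ^ 2 * rho p x - (N + (1 + 2 * (2 / (p - 1))) * Q)) ≤
      N := by
    refine setIntegral_mono_on (integrableOn_const (by simp)) hF measurableSet_Ioo fun z hz => ?_
    have h1 := hosc z hz
    have h2 : 0 ≤ h' z ^ 2 * (1 - z ^ 2) * rho p z := by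
      have := one_sub_sq_pos_of_mem_Ioo hz
      have := rho_pos p hz
      positivity
    linarith
  rw [setIntegral_const] at hmono
  norm_num at hmono
  linarith

lemma rpow_setIntegral_le {p M : ℝ} (hp : 1 < p) {h : ℝ → ℝ} (hM : 0 ≤ M)
    (hq : IntegrableOn (fun y => h y ^ 2 * rho p y / (1 - y ^ 2)) (Ioo (-1 : ℝ) 1))
    (hQ : ∫ y in Ioo (-1 : ℝ) 1, h y ^ 2 * rho p y / (1 - y ^ 2) ≤ M ^ 2)
    (hsup : ∀ y ∈ Ioo (-1 : ℝ) 1, |h y| * (1 - y ^ 2) ^ (1 / (p - 1)) ≤ M) :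
    (∫ y in Ioo (-1 : ℝ) 1, |h y| ^ (p + 1) * rho p y) ^ (2 / (p + 1)) ≤ M ^ 2 := by
  have hp1 : p - 1 ≠ 0 := by linarith
  have hpt : ∀ y ∈ Ioo (-1 : ℝ) 1, |h y| ^ (p + 1) * rho p y ≤
      M ^ (p - 1) * (h y ^ 2 * rho p y / (1 - y ^ 2)) := fun y hy => by
    have hs := one_sub_sq_pos_of_mem_Ioo hy
    have hr := rho_pos p hy
    have e : |h y| ^ (p + 1) = |h y| ^ (p - 1) * h y ^ 2 := by
      rw [← sq_abs, ← Real.rpow_natCast, ← Real.rpow_add' (abs_nonneg _)]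
      · congr 1; push_cast; ring
      · push_cast; linarith
    have h1 : |h y| ^ (p - 1) * (1 - y ^ 2) ≤ M ^ (p - 1) := by
      have := Real.rpow_le_rpow (by positivity) (hsup y hy) (by linarith : 0 ≤ p - 1)
      rwa [Real.mul_rpow (abs_nonneg _) (by positivity), ← Real.rpow_mul hs.le,
        one_div_mul_cancel hp1, Real.rpow_one] at this
    calc |h y| ^ (p + 1) * rho p y
        = |h y| ^ (p - 1) * (1 - y ^ 2) * (h y ^ 2 * rho p y / (1 - y ^ 2)) := by
          rw [e]; field_simp
      _ ≤ _ := by gcongr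
  have hnonneg : ∀ y ∈ Ioo (-1 : ℝ) 1, 0 ≤ |h y| ^ (p + 1) * rho p y := fun y hy =>
    mul_nonneg (by positivity) (rho_pos p hy).le
  have hint : ∫ y in Ioo (-1 : ℝ) 1, |h y| ^ (p + 1) * rho p y ≤ M ^ (p + 1) := by
    calc _ ≤ ∫ y in Ioo (-1 : ℝ) 1, M ^ (p - 1) * (h y ^ 2 * rho p y / (1 - y ^ 2)) := by
          refine integral_mono_of_nonneg ?_ (hq.const_mul _) ?_
          · filter_upwards [ae_restrict_mem measurableSet_Ioo] with y hy using hnonneg y hy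
          · filter_upwards [ae_restrict_mem measurableSet_Ioo] with y hy using hpt y hy
      _ ≤ M ^ (p - 1) * M ^ 2 := by
          rw [integral_const_mul]; gcongr
      _ = M ^ (p + 1) := by
          rw [← Real.rpow_natCast, ← Real.rpow_add' hM]
          · congr 1; push_cast; ring
          · push_cast; linarith
  calc _ ≤ (M ^ (p + 1)) ^ (2 / (p + 1)) :=
        Real.rpow_le_rpow (setIntegral_nonneg measurableSet_Ioo hnonneg) hint (by positivity)
    _ = M ^ 2 := by
        rw [← Real.rpow_mul hM, mul_div_cancel₀ _ (by linarith : p + 1 ≠ 0)]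
        exact Real.rpow_two M

/-- Hardy–Sobolev type estimates: for every `h` with one (classical) derivative
on `(-1,1)` and finite `H₀` norm,
`‖h‖²_{L²_{ρ/(1-y²)}} ≤ C² ‖h‖²_{H₀}`, `‖h‖²_{L^{p+1}_ρ} ≤ C² ‖h‖²_{H₀}` and
`‖h (1-y²)^{1/(p-1)}‖_{L^∞} ≤ C ‖h‖_{H₀}`. -/
theorem stmt_17 (p : ℝ) (hp : 1 < p) :
    ∃ C : ℝ, 0 < C ∧ ∀ h h' : ℝ → ℝ,
      (∀ y ∈ Set.Ioo (-1:ℝ) 1, HasDerivAt h (h' y) y) →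
      MeasureTheory.IntegrableOn
        (fun y => ((h' y) ^ 2 * (1 - y ^ 2) + h y ^ 2) * rho p y) (Set.Ioo (-1:ℝ) 1) →
      (∫ y in Set.Ioo (-1:ℝ) 1, h y ^ 2 * rho p y / (1 - y ^ 2)) ≤
          C ^ 2 * ∫ y in Set.Ioo (-1:ℝ) 1, ((h' y) ^ 2 * (1 - y ^ 2) + h y ^ 2) * rho p y ∧
      (∫ y in Set.Ioo (-1:ℝ) 1, |h y| ^ (p + 1) * rho p y) ^ (2 / (p + 1)) ≤
          C ^ 2 * ∫ y in Set.Ioo (-1:ℝ) 1, ((h' y) ^ 2 * (1 - y ^ 2) + h y ^ 2) * rho p y ∧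
      ∀ y ∈ Set.Ioo (-1:ℝ) 1,
        |h y| * (1 - y ^ 2) ^ (1 / (p - 1)) ≤
          C * Real.sqrt
            (∫ y in Set.Ioo (-1:ℝ) 1, ((h' y) ^ 2 * (1 - y ^ 2) + h y ^ 2) * rho p y) := by
  have hα : 0 < 2 / (p - 1) := div_pos two_pos (by linarith)
  set α := 2 / (p - 1) with hαdef
  set K := (1 + 2 * α + 1 / α) / α with hK
  have hKpos : 0 < K := by positivity
  have hCpos : 0 < 2 + (1 + 2 * α) * K := by positivity
  refine ⟨Real.sqrt (2 + (1 + 2 * α) * K), Real.sqrt_pos.2 hCpos, fun h h' hd hF => ?_⟩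
  obtain ⟨hq, hQ⟩ := integrableOn_hardy_and_integral_le hp hd hF
  have hv := fun x (hx : x ∈ Ioo (-1 : ℝ) 1) => sq_mul_rho_le hp hd hF hx
  have hN : 0 ≤ ∫ y in Ioo (-1 : ℝ) 1, ((h' y) ^ 2 * (1 - y ^ 2) + h y ^ 2) * rho p y :=
    setIntegral_nonneg measurableSet_Ioo fun y hy => by
      have := one_sub_sq_pos_of_mem_Ioo hy
      have := rho_pos p hy
      positivity
  rw [← hαdef, ← hK] at hQ
  rw [← hαdef] at hv
  set N := ∫ y in Ioo (-1 : ℝ) 1, ((h' y) ^ 2 * (1 - y ^ 2) + h y ^ 2) * rho p y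
  have hM2 : (Real.sqrt (2 + (1 + 2 * α) * K) * Real.sqrt N) ^ 2 = (2 + (1 + 2 * α) * K) * N := by
    rw [mul_pow, Real.sq_sqrt hCpos.le, Real.sq_sqrt hN]
  have hQ' : ∫ y in Ioo (-1 : ℝ) 1, h y ^ 2 * rho p y / (1 - y ^ 2) ≤
      (2 + (1 + 2 * α) * K) * N :=
    hQ.trans (mul_le_mul_of_nonneg_right (by nlinarith [mul_pos hα hKpos]) hN)
  have hsup : ∀ y ∈ Ioo (-1 : ℝ) 1, |h y| * (1 - y ^ 2) ^ (1 / (p - 1)) ≤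
      Real.sqrt (2 + (1 + 2 * α) * K) * Real.sqrt N := fun y hy => by
    have hs := one_sub_sq_pos_of_mem_Ioo hy
    refine le_of_sq_le_sq ?_ (by positivity)
    have e : ((1 - y ^ 2) ^ (1 / (p - 1))) ^ 2 = rho p y := by
      rw [← Real.rpow_natCast, ← Real.rpow_mul hs.le, rho]
      congr 1; push_cast; ring
    rw [hM2, mul_pow, sq_abs, e]
    have := mul_le_mul_of_nonneg_left hQ (by positivity : 0 ≤ 1 + 2 * α)
    linarith [hv y hy]
  rw [Real.sq_sqrt hCpos.le]
  refine ⟨hQ', ?_, hsup⟩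
  rw [← hM2] at hQ' ⊢
  exact rpow_setIntegral_le hp (by positivity) hq hQ' hsup
end
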